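/- arXiv:2302.07458 — 6 statements merged into one kernel-verified Lean document; each statement's English description precedes it below -/
import Mathlib

section
/- Let α > 0 and λ > 0, and define a real sequence by θ_{k+1} = θ_k + α·λ·σ'(θ_k), where σ'(x) = exp(−x)/(1 + exp(−x))². Then the sequence (θ_k) diverges to +∞ for every choice of initial value θ_0. -/
noncomputable def sigmoid' (x : ℝ) : ℝ := Real.exp (-x) / (1 + Real.exp (-x)) ^ 2

theorem stmt2 (α lam : ℝ) (hα : 0 < α) (hlam : 0 < lam) (θ : ℕ → ℝ)
    (hθ : ∀ k, θ (k + 1) = θ k + α * lam * sigmoid' (θ k)) :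
    Filter.Tendsto θ Filter.atTop Filter.atTop := by
  have hpos : ∀ x, 0 < α * lam * sigmoid' x := by
    intro x
    unfold sigmoid'
    positivity
  have hmono : Monotone θ := monotone_nat_of_le_succ fun k => by
    rw [hθ k]
    linarith [hpos (θ k)]
  rcases tendsto_of_monotone hmono with h | ⟨l, hl⟩
  · exact h
  · exfalso
    have hcont : Continuous sigmoid' := by
      unfold sigmoid'
      refine Continuous.div (by fun_prop) (by fun_prop) fun x => ?_
      positivity
    have h1 : Filter.Tendsto (fun k => θ (k + 1)) Filter.atTop (nhds l) :=
      hl.comp (Filter.tendsto_add_atTop_nat 1)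
    have h2 : Filter.Tendsto (fun k => θ (k + 1)) Filter.atTop
        (nhds (l + α * lam * sigmoid' l)) := by
      simp only [hθ]
      exact hl.add (((hcont.tendsto l).comp hl).const_mul (α * lam))
    have := tendsto_nhds_unique h1 h2
    linarith [hpos l]
end

section
/- Let α > 0 and λ > 0, and define a real sequence by θ_{k+1} = θ_k − α·λ·σ'(θ_k), where σ'(x) = exp(−x)/(1 + exp(−x))². Then the sequence (θ_k) is strictly monotonically decreasing, diverges to −∞, and for every finite real number M there exists a finite index k such that θ_k < −M. -/
theorem stmt4 (α lam : ℝ) (hα : 0 < α) (hlam : 0 < lam) (θ : ℕ → ℝ)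
    (hθ : ∀ k, θ (k + 1) = θ k - α * lam * sigmoid' (θ k)) :
    (∀ k, θ (k + 1) < θ k) ∧
    Filter.Tendsto θ Filter.atTop Filter.atBot ∧
    ∀ M : ℝ, ∃ k : ℕ, θ k < -M := by
  have hpos : ∀ x, 0 < α * lam * sigmoid' x := by
    intro x
    unfold sigmoid'
    positivity
  have hdec : ∀ k, θ (k + 1) < θ k := by
    intro k
    have h1 := hpos (θ k)
    have h2 := hθ k
    linarith
  have hcont : Continuous sigmoid' := by
    unfold sigmoid'
    refine Continuous.div (by fun_prop) (by fun_prop) ?_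
    intro x
    positivity
  have hlim : Filter.Tendsto θ Filter.atTop Filter.atBot := by
    rcases tendsto_of_antitone (antitone_nat_of_succ_le fun k => (hdec k).le) with h | ⟨l, hl⟩
    · exact h
    · exfalso
      have h1 := hl.comp (Filter.tendsto_add_atTop_nat 1)
      have h2 := hl.sub (((hcont.tendsto l).comp hl).const_mul (α * lam))
      have h3 := tendsto_nhds_unique (h1.congr fun k => hθ k) h2
      have h4 := hpos l
      linarith
  refine ⟨hdec, hlim, fun M => ?_⟩
  exact (hlim.eventually (Filter.eventually_lt_atBot (-M))).exists
end

section
/- Let α > 0 and λ > 0, and define a real sequence by θ_{k+1} = θ_k + α·λ·σ'(θ_k), where σ'(x) = exp(−x)/(1 + exp(−x))². Then the causal probabilities m_k := σ(θ_k) = 1/(1 + exp(−θ_k)) converge to 1 as k → ∞. -/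
noncomputable def sigmoid (x : ℝ) : ℝ := 1 / (1 + Real.exp (-x))

theorem stmt5 (α lam : ℝ) (hα : 0 < α) (hlam : 0 < lam) (θ : ℕ → ℝ)
    (hθ : ∀ k, θ (k + 1) = θ k + α * lam * sigmoid' (θ k)) :
    Filter.Tendsto (fun k => sigmoid (θ k)) Filter.atTop (nhds 1) := by
  have hpos : ∀ x, 0 < sigmoid' x := fun x => by unfold sigmoid'; positivity
  have hmono : Monotone θ := monotone_nat_of_le_succ fun k => by
    rw [hθ k]
    have := mul_pos (mul_pos hα hlam) (hpos (θ k))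
    linarith
  have hcont : Continuous sigmoid' := by
    unfold sigmoid'
    refine Continuous.div (by fun_prop) (by fun_prop) fun x => ?_
    positivity
  have htop : Filter.Tendsto θ Filter.atTop Filter.atTop := by
    rcases tendsto_of_monotone hmono with h | ⟨l, hl⟩
    · exact h
    · exfalso
      have h1 : Filter.Tendsto (fun k => θ (k + 1)) Filter.atTop (nhds l) :=
        hl.comp (Filter.tendsto_add_atTop_nat 1)
      have h2 : Filter.Tendsto (fun k => θ (k + 1)) Filter.atTop
          (nhds (l + α * lam * sigmoid' l)) := by
        simp only [hθ]
        exact hl.add (((hcont.tendsto l).comp hl).const_mul (α * lam))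
      have h3 := tendsto_nhds_unique h1 h2
      have := mul_pos (mul_pos hα hlam) (hpos l)
      linarith
  have he : Filter.Tendsto (fun k => Real.exp (-θ k)) Filter.atTop (nhds 0) :=
    Real.tendsto_exp_neg_atTop_nhds_zero.comp htop
  have h4 : Filter.Tendsto (fun k => 1 / (1 + Real.exp (-θ k))) Filter.atTop
      (nhds (1 / (1 + 0))) :=
    Filter.Tendsto.div tendsto_const_nhds (he.const_add 1) (by norm_num)
  simpa [sigmoid] using h4
end

section
/- Let α > 0 and λ > 0, and define a real sequence by θ_{k+1} = θ_k − α·λ·σ'(θ_k), where σ'(x) = exp(−x)/(1 + exp(−x))². Then the causal probabilities m_k := σ(θ_k) = 1/(1 + exp(−θ_k)) converge to 0 as k → ∞. -/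
theorem stmt6 (α lam : ℝ) (hα : 0 < α) (hlam : 0 < lam) (θ : ℕ → ℝ)
    (hθ : ∀ k, θ (k + 1) = θ k - α * lam * sigmoid' (θ k)) :
    Filter.Tendsto (fun k => sigmoid (θ k)) Filter.atTop (nhds 0) := by
  have hpos : ∀ x, 0 < sigmoid' x := fun x => by unfold sigmoid'; positivity
  have hanti : Antitone θ := antitone_nat_of_succ_le fun k => by
    rw [hθ k]
    have := mul_pos (mul_pos hα hlam) (hpos (θ k))
    linarith
  have hcont : Continuous sigmoid' := by
    unfold sigmoid'
    refine Continuous.div (by fun_prop) (by fun_prop) fun x => by positivity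
  have hbot : Filter.Tendsto θ Filter.atTop Filter.atBot := by
    rcases tendsto_of_antitone hanti with h | ⟨l, hl⟩
    · exact h
    · exfalso
      have h1 := (Filter.tendsto_add_atTop_iff_nat 1).2 hl
      have h2 : Filter.Tendsto (fun k => θ (k + 1)) Filter.atTop
          (nhds (l - α * lam * sigmoid' l)) := by
        simp only [hθ]
        exact hl.sub (((hcont.tendsto l).comp hl).const_mul _)
      have h3 := tendsto_nhds_unique h1 h2
      have := mul_pos (mul_pos hα hlam) (hpos l)
      linarith
  unfold sigmoid
  simp only [one_div]
  apply Filter.Tendsto.inv_tendsto_atTop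
  apply Filter.tendsto_atTop_add_const_left
  exact Real.tendsto_exp_atTop.comp (Filter.tendsto_neg_atBot_atTop.comp hbot)
end

section
/- Fix real numbers g₀ = g₁ and λ > 0, let F(θ) = σ(θ)·g₁ + (1 − σ(θ))·g₀ + λ·σ(θ) with σ(x) = 1/(1 + exp(−x)), and let α > 0. Define the gradient-descent sequence θ_{k+1} = θ_k − α·F'(θ_k). Then θ_k → −∞ and consequently the causal probability m_k := σ(θ_k) converges to 0. -/
theorem stmt13 (g₀ g₁ lam α : ℝ) (hg : g₀ = g₁) (hlam : 0 < lam) (hα : 0 < α)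
    (F : ℝ → ℝ)
    (hF : F = fun θ => sigmoid θ * g₁ + (1 - sigmoid θ) * g₀ + lam * sigmoid θ)
    (θ : ℕ → ℝ)
    (hθ : ∀ k, θ (k + 1) = θ k - α * deriv F (θ k)) :
    Filter.Tendsto θ Filter.atTop Filter.atBot ∧
    Filter.Tendsto (fun k => sigmoid (θ k)) Filter.atTop (nhds 0) := by
  have hs : sigmoid = Real.sigmoid := by
    funext x
    simp [sigmoid, Real.sigmoid_def]
  have hF2 : F = fun x => g₀ + lam * Real.sigmoid x := by
    rw [hF, hs, hg]
    funext x
    ring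
  have hd : ∀ x, deriv F x = lam * (Real.sigmoid x * (1 - Real.sigmoid x)) := by
    intro x
    rw [hF2]
    exact (((Real.hasDerivAt_sigmoid x).const_mul lam).const_add g₀).deriv
  have hpos : ∀ x, 0 < α * (lam * (Real.sigmoid x * (1 - Real.sigmoid x))) := by
    intro x
    have h1 := Real.sigmoid_pos x
    have h2 := sub_pos.mpr (Real.sigmoid_lt_one x)
    positivity
  simp only [hd] at hθ
  have hanti : Antitone θ := antitone_nat_of_succ_le fun k => by
    rw [hθ k]
    linarith [hpos (θ k)]
  have hmain : Filter.Tendsto θ Filter.atTop Filter.atBot := by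
    rcases tendsto_atTop_of_antitone hanti with h | ⟨l, hl⟩
    · exact h
    · exfalso
      have hc : Continuous fun x : ℝ =>
          x - α * (lam * (Real.sigmoid x * (1 - Real.sigmoid x))) := by
        have := continuous_sigmoid
        fun_prop
      have h1 := (hc.tendsto l).comp hl
      have h2 := hl.comp (Filter.tendsto_add_atTop_nat 1)
      have h3 : θ ∘ (fun k => k + 1) = (fun x : ℝ =>
          x - α * (lam * (Real.sigmoid x * (1 - Real.sigmoid x)))) ∘ θ := by
        funext k
        exact hθ k
      rw [h3] at h2
      have h4 := tendsto_nhds_unique h1 h2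
      linarith [hpos l]
  refine ⟨hmain, ?_⟩
  rw [hs]
  exact Real.tendsto_sigmoid_atBot.comp hmain
end

section
/- Fix real numbers g₀, g₁ and λ with λ > 0 and g₀ − g₁ > λ, let F(θ) = σ(θ)·g₁ + (1 − σ(θ))·g₀ + λ·σ(θ) with σ(x) = 1/(1 + exp(−x)), and let α > 0. Define the gradient-descent sequence θ_{k+1} = θ_k − α·F'(θ_k). Then θ_k → +∞ and consequently the causal probability m_k := σ(θ_k) converges to 1. -/
theorem sigmoid_hasDerivAt (x : ℝ) :
    HasDerivAt sigmoid (Real.exp (-x) / (1 + Real.exp (-x)) ^ 2) x := by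
  have h1 : HasDerivAt (fun y : ℝ => 1 + Real.exp (-y)) (Real.exp (-x) * (-1)) x :=
    ((hasDerivAt_neg x).exp).const_add 1
  have hne : 1 + Real.exp (-x) ≠ 0 := by positivity
  have h2 := (hasDerivAt_const x (1 : ℝ)).fun_div h1 hne
  have h3 : sigmoid = fun y : ℝ => 1 / (1 + Real.exp (-y)) := rfl
  rw [h3]
  refine h2.congr_deriv ?_
  congr 1
  ring

theorem stmt14 (g₀ g₁ lam α : ℝ) (hlam : 0 < lam) (hgap : g₀ - g₁ > lam) (hα : 0 < α)
    (F : ℝ → ℝ)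
    (hF : F = fun θ => sigmoid θ * g₁ + (1 - sigmoid θ) * g₀ + lam * sigmoid θ)
    (θ : ℕ → ℝ)
    (hθ : ∀ k, θ (k + 1) = θ k - α * deriv F (θ k)) :
    Filter.Tendsto θ Filter.atTop Filter.atTop ∧
    Filter.Tendsto (fun k => sigmoid (θ k)) Filter.atTop (nhds 1) := by
  have hd : ∀ x, deriv F x = (Real.exp (-x) / (1 + Real.exp (-x)) ^ 2) * (g₁ - g₀ + lam) := by
    intro x
    have hs := sigmoid_hasDerivAt x
    have h := ((hs.mul_const g₁).fun_add ((hs.const_sub 1).mul_const g₀)).fun_add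
      (hs.const_mul lam)
    rw [hF, h.deriv]
    ring
  set c : ℝ := α * (g₀ - g₁ - lam) with hc
  have hcpos : 0 < c := mul_pos hα (by linarith)
  have hstep : ∀ k, θ (k + 1) =
      θ k + c * (Real.exp (-(θ k)) / (1 + Real.exp (-(θ k))) ^ 2) := by
    intro k
    rw [hθ k, hd, hc]
    ring
  have hmono : Monotone θ := by
    apply monotone_nat_of_le_succ
    intro k
    rw [hstep k]
    have : 0 ≤ c * (Real.exp (-(θ k)) / (1 + Real.exp (-(θ k))) ^ 2) := by positivity
    linarith
  have htop : Filter.Tendsto θ Filter.atTop Filter.atTop := by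
    rcases tendsto_atTop_of_monotone hmono with h | ⟨l, hl⟩
    · exact h
    · exfalso
      have hcont : Continuous
          (fun x : ℝ => x + c * (Real.exp (-x) / (1 + Real.exp (-x)) ^ 2)) := by
        refine continuous_id.add (continuous_const.mul (Continuous.div (by fun_prop)
          (by fun_prop) ?_))
        intro x
        positivity
      have h1 := (hcont.tendsto l).comp hl
      have h2 := (Filter.tendsto_add_atTop_iff_nat 1).2 hl
      have h3 := tendsto_nhds_unique (h2.congr hstep) h1
      have : 0 < c * (Real.exp (-l) / (1 + Real.exp (-l)) ^ 2) := by positivity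
      linarith
  refine ⟨htop, ?_⟩
  have h1 : Filter.Tendsto (fun k => Real.exp (-(θ k))) Filter.atTop (nhds 0) :=
    Real.tendsto_exp_neg_atTop_nhds_zero.comp htop
  have h2 := (tendsto_const_nhds (x := (1 : ℝ))).div (h1.const_add 1) (by norm_num)
  rw [add_zero, div_one] at h2
  exact h2
end
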